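/- arXiv:2504.07390 — 2 statements merged into one kernel-verified Lean document; each statement's English description precedes it below -/
import Mathlib

section
/- Let n ≥ 1, l ≥ 1. Let M_1, …, M_l be n×n complex matrices with ‖M_j‖ ≤ 1, let P_1, …, P_l be n×n orthogonal projections with M_j P_j = P_j M_j = P_j and ‖M_j − P_j‖ ≤ 1 for all j, and let C_1, …, C_l be n×n orthogonal projections such that C_1 = P_1; for each j ∈ {2,…,l}: P_j C_j = C_j P_j = C_j and C_{j−1} C_j = C_j C_{j−1} = C_j; and for every j ∈ {1,…,l}: M_j C_l = C_l M_j = C_l. Set α_j := 1 − ‖M_j − P_j‖² for j ∈ {1,…,l} and γ_j := 1 − ‖P_j C_{j−1} − C_j‖² for j ∈ {2,…,l}. Then ‖M_l ⋯ M_2 M_1 − C_l‖² ≤ 1 − (∏_{j=1}^{l} α_j)·(∏_{j=2}^{l} γ_j). -/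
open Matrix

/-- The operator norm of a square complex matrix (largest singular value). -/
noncomputable def opNorm {n : Type*} [Fintype n] [DecidableEq n] (A : Matrix n n ℂ) : ℝ :=
  ‖Matrix.toEuclideanCLM (𝕜 := ℂ) A‖

section helpers
variable {E : Type*} [NormedAddCommGroup E] [InnerProductSpace ℂ E] [CompleteSpace E]

lemma aux_inner {P : E →L[ℂ] E} (hs : star P = P) (x y : E) :
    inner ℂ (P x) y = inner ℂ x (P y) := by
  conv_lhs => rw [← hs]
  rw [ContinuousLinearMap.star_eq_adjoint, ContinuousLinearMap.adjoint_inner_left]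

/-- Pythagoras for an orthogonal projection. -/
lemma aux_pyth {P : E →L[ℂ] E} (hs : star P = P) (hi : P * P = P) (x : E) :
    ‖x‖ ^ 2 = ‖P x‖ ^ 2 + ‖x - P x‖ ^ 2 := by
  have hPP : P (P x) = P x := DFunLike.congr_fun hi x
  have h0 : inner ℂ (P x) (x - P x) = 0 := by
    rw [aux_inner hs, map_sub, hPP, sub_self, inner_zero_right]
  have := norm_add_sq_eq_norm_sq_add_norm_sq_of_inner_eq_zero (P x) (x - P x) h0
  rw [add_sub_cancel] at this
  nlinarith [this]

lemma aux_opnorm {T : E →L[ℂ] E} {K : ℝ} (hK : 0 ≤ K) (h : ∀ x, ‖T x‖ ^ 2 ≤ K * ‖x‖ ^ 2) :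
    ‖T‖ ^ 2 ≤ K := by
  have : ‖T‖ ≤ √K := by
    refine T.opNorm_le_bound (Real.sqrt_nonneg _) fun x => ?_
    refine le_of_sq_le_sq ?_ (by positivity)
    rw [mul_pow, Real.sq_sqrt hK]
    exact h x
  calc ‖T‖ ^ 2 ≤ √K ^ 2 := by gcongr
    _ = K := Real.sq_sqrt hK

lemma aux_le {T : E →L[ℂ] E} (x : E) : ‖T x‖ ^ 2 ≤ ‖T‖ ^ 2 * ‖x‖ ^ 2 := by
  rw [← mul_pow]
  gcongr
  exact T.le_opNorm x

lemma aux_gamma {P C D : E →L[ℂ] E} (hPs : star P = P) (hPi : P * P = P)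
    (hCs : star C = C) (hCi : C * C = C) (hDs : star D = D) (hDi : D * D = D)
    (hPD : P * D = D) (hCD : C * D = D) : ‖P * C - D‖ ^ 2 ≤ 1 := by
  refine aux_opnorm zero_le_one fun x => ?_
  have h1 : (P * C - D) x = P (C (x - D x)) := by
    have e1 : P (D x) = D x := DFunLike.congr_fun hPD x
    have e2 : C (D x) = D x := DFunLike.congr_fun hCD x
    simp [map_sub, e1, e2]
  rw [h1]
  nlinarith [aux_pyth hPs hPi (C (x - D x)), aux_pyth hCs hCi (x - D x), aux_pyth hDs hDi x,
    sq_nonneg ‖C (x - D x) - P (C (x - D x))‖, sq_nonneg ‖x - D x - C (x - D x)‖,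
    sq_nonneg ‖D x‖]

lemma aux_real {s p q a b v g c : ℝ} (hs : 0 ≤ s) (hq : 0 ≤ q) (ha : 0 ≤ a) (hp : 0 ≤ p)
    (hb : 0 ≤ b) (hv0 : 0 ≤ v) (hg : 0 ≤ g) (hc : 0 ≤ c)
    (h1 : s ^ 2 ≤ a * p + b * v) (hv : v ^ 2 ≤ (1 - g) * q ^ 2)
    (hab : s ^ 2 = a ^ 2 + b ^ 2) (hac : a ^ 2 ≤ c * s ^ 2) (hg1 : g ≤ 1) :
    s ^ 2 ≤ (1 - g * (1 - c)) * (p ^ 2 + q ^ 2) := by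
  have hK : 0 ≤ 1 - g * (1 - c) := by nlinarith [mul_nonneg hg hc]
  rcases hs.eq_or_lt with rfl | hs
  · have : 0 ≤ (1 - g * (1 - c)) * (p ^ 2 + q ^ 2) := by positivity
    simpa using this
  · obtain ⟨r, hr0, hr⟩ : ∃ r : ℝ, 0 ≤ r ∧ r ^ 2 = 1 - g :=
      ⟨√(1 - g), Real.sqrt_nonneg _, Real.sq_sqrt (by linarith)⟩
    have hvr : v ≤ r * q := by
      refine le_of_sq_le_sq ?_ (by positivity)
      rw [mul_pow, hr]
      exact hv
    have h2 : s ^ 2 ≤ a * p + b * r * q := by nlinarith [mul_le_mul_of_nonneg_left hvr hb]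
    have h3 : (s ^ 2) ^ 2 ≤ (a * p + b * r * q) ^ 2 := by gcongr
    have h4 : (a * p + b * r * q) ^ 2 ≤ (a ^ 2 + b ^ 2 * r ^ 2) * (p ^ 2 + q ^ 2) := by
      nlinarith [sq_nonneg (a * q - b * r * p)]
    have h5 : a ^ 2 + b ^ 2 * r ^ 2 ≤ s ^ 2 * (1 - g * (1 - c)) := by
      rw [hr]
      nlinarith [mul_le_mul_of_nonneg_left hac hg]
    have h6 : (a ^ 2 + b ^ 2 * r ^ 2) * (p ^ 2 + q ^ 2)
        ≤ s ^ 2 * (1 - g * (1 - c)) * (p ^ 2 + q ^ 2) := by gcongr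
    have h7 : s ^ 2 * s ^ 2 ≤ s ^ 2 * ((1 - g * (1 - c)) * (p ^ 2 + q ^ 2)) := by nlinarith
    exact le_of_mul_le_mul_left h7 (by positivity)

lemma aux_step {A M P C D : E →L[ℂ] E} {g : ℝ} (hg : 0 ≤ g) (hg1 : g ≤ 1)
    (hPs : star P = P) (hPi : P * P = P)
    (hCs : star C = C) (hCi : C * C = C) (hDs : star D = D) (hDi : D * D = D)
    (hPD : P * D = D) (hDP : D * P = D) (hCD : C * D = D)
    (hMP : M * P = P) (hPM : P * M = P) (hMPn : ‖M - P‖ ≤ 1)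
    (hA : ‖A‖ ≤ 1) (hAC : A * C = C) (hCA : C * A = C) (hAD : A * D = D) (hDA : D * A = D)
    (hgap : ‖A - C‖ ^ 2 ≤ 1 - g) :
    ‖M * A - D‖ ^ 2 ≤ 1 - g * ((1 - ‖M - P‖ ^ 2) * (1 - ‖P * C - D‖ ^ 2)) := by
  have hγ := aux_gamma hPs hPi hCs hCi hDs hDi hPD hCD
  have hα : ‖M - P‖ ^ 2 ≤ 1 := pow_le_one₀ (norm_nonneg _) hMPn
  have hα0 : 0 ≤ ‖M - P‖ ^ 2 := sq_nonneg _
  have hγ0 : 0 ≤ ‖P * C - D‖ ^ 2 := sq_nonneg _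
  have hMD : M * D = D := by rw [← hPD, ← mul_assoc, hMP]
  have hN : ‖C * P - D‖ = ‖P * C - D‖ := by
    rw [← norm_star (P * C - D), star_sub, star_mul, hPs, hCs, hDs]
  set a := ‖M - P‖ ^ 2 with ha
  set c := ‖P * C - D‖ ^ 2 with hc
  have hK : g * ((1 - a) * (1 - c)) ≤ 1 := by
    have h1 : (1 - a) * (1 - c) ≤ 1 := mul_le_one₀ (by linarith) (by linarith) (by linarith)
    have h2 : 0 ≤ (1 - a) * (1 - c) := mul_nonneg (by linarith) (by linarith)
    exact mul_le_one₀ hg1 h2 h1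
  refine aux_opnorm (by linarith) fun x => ?_
  obtain ⟨z, hz⟩ : ∃ z, z = x - D x := ⟨_, rfl⟩
  have hDz : D z = 0 := by
    have : D (D x) = D x := DFunLike.congr_fun hDi x
    rw [hz, map_sub, this, sub_self]
  have hzx : ‖z‖ ^ 2 ≤ ‖x‖ ^ 2 := by
    rw [hz]; nlinarith [aux_pyth hDs hDi x, sq_nonneg ‖D x‖]
  obtain ⟨y, hy⟩ : ∃ y, y = A z := ⟨_, rfl⟩
  have hTx : (M * A - D) x = M y := by
    have e1 : A (D x) = D x := DFunLike.congr_fun hAD x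
    have e2 : M (D x) = D x := DFunLike.congr_fun hMD x
    simp [hy, hz, map_sub, e1, e2]
  obtain ⟨w, hw⟩ : ∃ w, w = P y := ⟨_, rfl⟩
  have hPw : P w = w := by rw [hw]; exact DFunLike.congr_fun hPi y
  have hDw : D w = 0 := by
    have e1 : D (P y) = D y := DFunLike.congr_fun hDP y
    have e2 : D (A z) = D z := DFunLike.congr_fun hDA z
    rw [hw, e1, hy, e2, hDz]
  have hy1 : ‖y‖ ^ 2 ≤ ‖z‖ ^ 2 := by
    have h : ‖y‖ ≤ ‖z‖ := by
      rw [hy]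
      calc ‖A z‖ ≤ ‖A‖ * ‖z‖ := A.le_opNorm z
        _ ≤ 1 * ‖z‖ := by gcongr
        _ = ‖z‖ := one_mul _
    gcongr
  -- bound on `w`
  have hCz : C (C z) = C z := DFunLike.congr_fun hCi z
  have hCy : C y = C z := by rw [hy]; exact DFunLike.congr_fun hCA z
  have hv : ‖y - C z‖ ^ 2 ≤ (1 - g) * ‖z - C z‖ ^ 2 := by
    have e1 : A (C z) = C z := DFunLike.congr_fun hAC z
    have e : (A - C) (z - C z) = y - C z := by
      simp [hy, map_sub, e1, hCz]
    rw [← e]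
    refine aux_le _ |>.trans ?_
    gcongr
  have hCw : ‖C w‖ ^ 2 ≤ c * ‖w‖ ^ 2 := by
    have e : (C * P - D) w = C w := by simp [hPw, hDw]
    rw [← e, hc, ← hN]
    exact aux_le _
  have hww : ‖w‖ ^ 2 ≤ ‖C w‖ * ‖C z‖ + ‖w - C w‖ * ‖y - C z‖ := by
    have e1 : inner ℂ w w = inner ℂ (C w) (C z) + inner ℂ (w - C w) (y - C z) := by
      have f1 : inner ℂ w w = inner ℂ w y := by
        have f0 := aux_inner hPs w y
        rw [hPw, ← hw] at f0
        exact f0.symm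
      have f2 : inner ℂ (C w) (y - C z) = 0 := by
        rw [aux_inner hCs, map_sub, hCz, hCy, sub_self, inner_zero_right]
      have f3 : inner ℂ (C w) (C z) = inner ℂ w (C z) := by
        rw [aux_inner hCs, hCz]
      rw [f1, inner_sub_left, f2, f3, sub_zero, ← inner_add_right, add_sub_cancel]
    have e2 : ‖w‖ ^ 2 = ‖inner ℂ w w‖ := by
      rw [inner_self_eq_norm_sq_to_K]; simp
    rw [e2, e1]
    exact (norm_add_le _ _).trans (add_le_add (norm_inner_le_norm _ _) (norm_inner_le_norm _ _))
  have hwz : ‖w‖ ^ 2 ≤ (1 - g * (1 - c)) * ‖z‖ ^ 2 := by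
    rw [aux_pyth hCs hCi z]
    exact aux_real (norm_nonneg _) (norm_nonneg _) (norm_nonneg _) (norm_nonneg _)
      (norm_nonneg _) (norm_nonneg _) hg hγ0 hww hv (aux_pyth hCs hCi w) hCw hg1
  -- bound on `M y`
  have hMy : ‖M y‖ ^ 2 ≤ ‖w‖ ^ 2 + a * ‖y - w‖ ^ 2 := by
    have e1 : P (M y) = w := by rw [hw]; exact DFunLike.congr_fun hPM y
    have e2 : M (P y) = P y := DFunLike.congr_fun hMP y
    have e3 : (M - P) (y - w) = M y - w := by
      rw [hw] at hPw ⊢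
      simp [map_sub, e2, hPw]
    rw [aux_pyth hPs hPi (M y), e1, ← e3]
    gcongr
    exact aux_le _
  have hyw : ‖y‖ ^ 2 = ‖w‖ ^ 2 + ‖y - w‖ ^ 2 := by rw [hw]; exact aux_pyth hPs hPi y
  rw [hTx]
  have h1 : ‖M y‖ ^ 2 ≤ (1 - a) * ‖w‖ ^ 2 + a * ‖y‖ ^ 2 := by rw [hyw]; linarith
  have h2 : (1 - a) * ‖w‖ ^ 2 ≤ (1 - a) * ((1 - g * (1 - c)) * ‖z‖ ^ 2) :=
    mul_le_mul_of_nonneg_left hwz (by linarith)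
  have h3 : a * ‖y‖ ^ 2 ≤ a * ‖z‖ ^ 2 := mul_le_mul_of_nonneg_left hy1 hα0
  have h4 : (1 - g * ((1 - a) * (1 - c))) * ‖z‖ ^ 2 ≤ (1 - g * ((1 - a) * (1 - c))) * ‖x‖ ^ 2 :=
    mul_le_mul_of_nonneg_left hzx (by linarith)
  linarith

end helpers

/-- Lemma S7, the non-Haar generalization of the decomposition lemma
of Belkin et al..  With moment operators `M j`, cluster projectors `P j`, combined
projectors `C j`, `α_j := 1 - ‖M j - P j‖²` and `γ_j := 1 - ‖P j * C (j-1) - C j‖²`,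
we have `‖M l ⋯ M 1 - C l‖² ≤ 1 - (∏_{j=1}^{l} α_j)(∏_{j=2}^{l} γ_j)`. -/
theorem nonHaar_block_gap_decomposition
    (n l : ℕ) (hn : 1 ≤ n) (hl : 1 ≤ l)
    (M P C : ℕ → Matrix (Fin n) (Fin n) ℂ)
    (hMnorm : ∀ j, 1 ≤ j → j ≤ l → opNorm (M j) ≤ 1)
    (hP_herm : ∀ j, 1 ≤ j → j ≤ l → (P j)ᴴ = P j)
    (hP_idem : ∀ j, 1 ≤ j → j ≤ l → P j * P j = P j)
    (hMP : ∀ j, 1 ≤ j → j ≤ l → M j * P j = P j ∧ P j * M j = P j)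
    (hMPnorm : ∀ j, 1 ≤ j → j ≤ l → opNorm (M j - P j) ≤ 1)
    (hC_herm : ∀ j, 1 ≤ j → j ≤ l → (C j)ᴴ = C j)
    (hC_idem : ∀ j, 1 ≤ j → j ≤ l → C j * C j = C j)
    (hC1 : C 1 = P 1)
    (hPC : ∀ j, 2 ≤ j → j ≤ l → P j * C j = C j ∧ C j * P j = C j)
    (hCC : ∀ j, 2 ≤ j → j ≤ l → C (j - 1) * C j = C j ∧ C j * C (j - 1) = C j)
    (hMCl : ∀ j, 1 ≤ j → j ≤ l → M j * C l = C l ∧ C l * M j = C l) :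
    opNorm ((List.ofFn fun j : Fin l => M (j.val + 1)).reverse.prod - C l) ^ 2 ≤
      1 - (∏ j ∈ Finset.Icc 1 l, (1 - opNorm (M j - P j) ^ 2)) *
        ∏ j ∈ Finset.Icc 2 l, (1 - opNorm (P j * C (j - 1) - C j) ^ 2) := by
  let φ := Matrix.toEuclideanCLM (n := Fin n) (𝕜 := ℂ)
  have hφ : ∀ B, opNorm B = ‖φ B‖ := fun B => rfl
  have hφm : ∀ {X Y Z : Matrix (Fin n) (Fin n) ℂ}, X * Y = Z → φ X * φ Y = φ Z := by
    intro X Y Z h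
    rw [← h, map_mul]
  have hφs : ∀ {X : Matrix (Fin n) (Fin n) ℂ}, Xᴴ = X → star (φ X) = φ X := by
    intro X h
    rw [← map_star, Matrix.star_eq_conjTranspose, h]
  let A : ℕ → Matrix (Fin n) (Fin n) ℂ := fun k =>
    (List.ofFn fun j : Fin k => M (j.val + 1)).reverse.prod
  have hA0 : A 0 = 1 := by simp [A]
  have hA1 : ∀ k, A (k + 1) = M (k + 1) * A k := by
    intro k
    simp only [A]
    rw [List.ofFn_succ']
    simp [List.concat_eq_append]
  -- nesting of the projections
  have hPCall : ∀ j, 1 ≤ j → j ≤ l → ∀ k, 1 ≤ k → k ≤ j →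
      P k * C j = C j ∧ C j * P k = C j := by
    intro j hj
    induction j, hj using Nat.le_induction with
    | base =>
      intro hjl k hk hk1
      obtain rfl : k = 1 := le_antisymm hk1 hk
      rw [hC1]
      exact ⟨hP_idem 1 le_rfl hjl, hP_idem 1 le_rfl hjl⟩
    | succ j hj ih =>
      intro hjl k hk hkj
      rcases Nat.lt_or_ge k (j + 1) with h | h
      · obtain ⟨i1, i2⟩ := ih (by omega) k hk (by omega)
        obtain ⟨c1, c2⟩ := hCC (j + 1) (by omega) hjl
        rw [Nat.add_sub_cancel] at c1 c2
        constructor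
        · rw [← c1, ← mul_assoc, i1]
        · rw [← c2, mul_assoc, i2]
      · obtain rfl : k = j + 1 := le_antisymm hkj h
        exact hPC _ (by omega) hjl
  have hMCall : ∀ j, j ≤ l → ∀ k, 1 ≤ k → k ≤ j → M k * C j = C j ∧ C j * M k = C j := by
    intro j hjl k hk hkj
    obtain ⟨i1, i2⟩ := hPCall j (by omega) hjl k hk hkj
    obtain ⟨m1, m2⟩ := hMP k hk (by omega)
    constructor
    · rw [← i1, ← mul_assoc, m1]
    · rw [← i2, mul_assoc, m2]
  have hAC : ∀ j, j ≤ l → ∀ k, k ≤ j → A k * C j = C j ∧ C j * A k = C j := by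
    intro j hjl k
    induction k with
    | zero => intro _; simp [hA0]
    | succ k ih =>
      intro hk
      obtain ⟨i1, i2⟩ := ih (by omega)
      obtain ⟨m1, m2⟩ := hMCall j hjl (k + 1) (by omega) hk
      rw [hA1]
      constructor
      · rw [mul_assoc, i1, m1]
      · rw [← mul_assoc, m2, i2]
  have hAn : ∀ k, k ≤ l → ‖φ (A k)‖ ≤ 1 := by
    intro k
    induction k with
    | zero =>
      intro _
      rw [hA0, map_one]
      exact ContinuousLinearMap.norm_id_le
    | succ k ih =>
      intro hk
      rw [hA1, map_mul]
      exact (norm_mul_le _ _).trans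
        (mul_le_one₀ (hMnorm (k + 1) (by omega) hk) (norm_nonneg _) (ih (by omega)))
  let g : ℕ → ℝ := fun l => (∏ j ∈ Finset.Icc 1 l, (1 - opNorm (M j - P j) ^ 2)) *
        ∏ j ∈ Finset.Icc 2 l, (1 - opNorm (P j * C (j - 1) - C j) ^ 2)
  have main : ∀ k, 1 ≤ k → k ≤ l → 0 ≤ g k ∧ g k ≤ 1 ∧ ‖φ (A k) - φ (C k)‖ ^ 2 ≤ 1 - g k := by
    intro k hk
    induction k, hk using Nat.le_induction with
    | base =>
      intro h1
      have hg : g 1 = 1 - opNorm (M 1 - P 1) ^ 2 := by simp [g]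
      have hn0 : 0 ≤ opNorm (M 1 - P 1) := norm_nonneg _
      have hn1 := hMPnorm 1 le_rfl h1
      refine ⟨by rw [hg]; nlinarith, by rw [hg]; nlinarith, ?_⟩
      have : A 1 = M 1 := by rw [hA1, hA0, mul_one]
      rw [hg, this, hC1, ← map_sub, ← hφ]
      linarith
    | succ k hk ih =>
      intro hkl
      obtain ⟨g0, g1, ig⟩ := ih (by omega)
      have hg : g (k + 1) = g k * ((1 - ‖φ (M (k + 1)) - φ (P (k + 1))‖ ^ 2) *
          (1 - ‖φ (P (k + 1)) * φ (C k) - φ (C (k + 1))‖ ^ 2)) := by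
        simp only [g]
        rw [Finset.prod_Icc_succ_top (by omega), Finset.prod_Icc_succ_top (by omega),
          Nat.add_sub_cancel, hφ, hφ, map_sub, map_sub, map_mul]
        ring
      have b1 : 1 ≤ k + 1 := by omega
      obtain ⟨c1, c2⟩ := hCC (k + 1) (by omega) hkl
      rw [Nat.add_sub_cancel] at c1 c2
      have hPs := hφs (hP_herm _ b1 hkl)
      have hPi := hφm (hP_idem _ b1 hkl)
      have hCs := hφs (hC_herm k hk (by omega))
      have hCi := hφm (hC_idem k hk (by omega))
      have hDs := hφs (hC_herm _ b1 hkl)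
      have hDi := hφm (hC_idem _ b1 hkl)
      obtain ⟨p1, p2⟩ := hPC (k + 1) (by omega) hkl
      obtain ⟨m1, m2⟩ := hMP (k + 1) (by omega) hkl
      have hn1 : ‖φ (M (k + 1)) - φ (P (k + 1))‖ ≤ 1 := by
        rw [← map_sub]
        exact hMPnorm _ b1 hkl
      obtain ⟨a1, a2⟩ := hAC k (by omega) k le_rfl
      obtain ⟨d1, d2⟩ := hAC (k + 1) hkl k (by omega)
      have hγ := aux_gamma hPs hPi hCs hCi hDs hDi (hφm p1) (hφm c1)
      have hα : ‖φ (M (k + 1)) - φ (P (k + 1))‖ ^ 2 ≤ 1 := pow_le_one₀ (norm_nonneg _) hn1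
      have hst := aux_step g0 g1 hPs hPi hCs hCi hDs hDi (hφm p1) (hφm p2) (hφm c1)
        (hφm m1) (hφm m2) hn1 (hAn k (by omega)) (hφm a1) (hφm a2) (hφm d1) (hφm d2) ig
      rw [← hg, ← map_mul, ← hA1] at hst
      refine ⟨?_, ?_, hst⟩
      · rw [hg]
        exact mul_nonneg g0 (mul_nonneg (by linarith) (by linarith))
      · linarith [sq_nonneg ‖φ (A (k + 1)) - φ (C (k + 1))‖]
  have := (main l hl le_rfl).2.2
  rw [← map_sub] at this
  exact this
end

section
/- Let q ≥ 1 and let ν be a finite unitary ensemble on U(q) given by unitaries U_1, …, U_m with weights p_1, …, p_m ≥ 0 summing to 1. Then the following are equivalent: (i) for every t ≥ 1, the spectral radius of M_ν^{(t)} − M_Haar^{(t)} is strictly less than 1; (ii) the support {U_k : p_k > 0} of ν is a universal gate set on U(q). -/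
open MeasureTheory

noncomputable instance (q : ℕ) : MeasurableSpace (Matrix.unitaryGroup (Fin q) ℂ) := borel _
instance (q : ℕ) : BorelSpace (Matrix.unitaryGroup (Fin q) ℂ) := ⟨rfl⟩

/-- The phase-invariant distance `D(V,W) = min_{φ ∈ [0,2π)} ‖V - e^{iφ} W‖`. -/
noncomputable def Ddist (q : ℕ) (V W : Matrix (Fin q) (Fin q) ℂ) : ℝ :=
  sInf ((fun φ : ℝ => opNorm (V - Complex.exp (φ * Complex.I) • W)) '' Set.Ico 0 (2 * Real.pi))

/-- A set `S` of unitaries is a universal gate set if every unitary can be approximated,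
up to a global phase and to arbitrary precision, by finite products of elements of `S`. -/
def IsUniversalGateSet (q : ℕ) (S : Set (Matrix.unitaryGroup (Fin q) ℂ)) : Prop :=
  ∀ V : Matrix.unitaryGroup (Fin q) ℂ, ∀ ε : ℝ, 0 < ε →
    ∃ ws : List (Matrix.unitaryGroup (Fin q) ℂ), (∀ w ∈ ws, w ∈ S) ∧
      Ddist q (V : Matrix (Fin q) (Fin q) ℂ)
        ((ws.prod : Matrix.unitaryGroup (Fin q) ℂ) : Matrix (Fin q) (Fin q) ℂ) ≤ ε

/-- The matrix `U^{⊗t,t} = U^{⊗t} ⊗ (conj U)^{⊗t}`. -/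
def tensorTT (q t : ℕ) (U : Matrix (Fin q) (Fin q) ℂ) :
    Matrix ((Fin t → Fin q) × (Fin t → Fin q)) ((Fin t → Fin q) × (Fin t → Fin q)) ℂ :=
  Matrix.of fun i j => (∏ s, U (i.1 s) (j.1 s)) * ∏ s, (starRingEnd ℂ) (U (i.2 s) (j.2 s))

/-- The `t`-th moment operator `M_ν^{(t)} = ∑ₖ pₖ Uₖ^{⊗t,t}` of a finite unitary ensemble. -/
noncomputable def momentOp (q t m : ℕ) (p : Fin m → ℝ)
    (U : Fin m → Matrix.unitaryGroup (Fin q) ℂ) :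
    Matrix ((Fin t → Fin q) × (Fin t → Fin q)) ((Fin t → Fin q) × (Fin t → Fin q)) ℂ :=
  ∑ k, (p k : ℂ) • tensorTT q t (U k : Matrix (Fin q) (Fin q) ℂ)

/-- The `t`-th Haar moment operator `M_Haar^{(t)} = ∫ U^{⊗t,t} dμ(U)`, defined entrywise. -/
noncomputable def MHaarOp (q t : ℕ) (μ : Measure (Matrix.unitaryGroup (Fin q) ℂ)) :
    Matrix ((Fin t → Fin q) × (Fin t → Fin q)) ((Fin t → Fin q) × (Fin t → Fin q)) ℂ :=
  Matrix.of fun i j => ∫ U, tensorTT q t (U : Matrix (Fin q) (Fin q) ℂ) i j ∂μ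


lemma tensorTT_mul (q t : ℕ) (A B : Matrix (Fin q) (Fin q) ℂ) :
    tensorTT q t (A * B) = tensorTT q t A * tensorTT q t B := by
  ext i j
  simp only [tensorTT, Matrix.of_apply, Matrix.mul_apply, map_sum, map_mul]
  rw [Finset.prod_univ_sum, Finset.prod_univ_sum, Finset.sum_mul_sum, ← Finset.sum_product',
    Fintype.piFinset_univ, Finset.univ_product_univ]
  refine Finset.sum_congr rfl fun k _ => ?_
  simp only [Finset.prod_mul_distrib]
  ring

lemma tensorTT_one (q t : ℕ) : tensorTT q t 1 = 1 := by
  ext i j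
  simp only [tensorTT, Matrix.of_apply, Matrix.one_apply]
  by_cases h : i = j
  · subst h; simp
  · rw [if_neg h]
    have : i.1 ≠ j.1 ∨ i.2 ≠ j.2 := by
      by_contra! hc
      exact h (Prod.ext hc.1 hc.2)
    rcases this with h | h
    · obtain ⟨s, hs⟩ := Function.ne_iff.1 h
      rw [Finset.prod_eq_zero (Finset.mem_univ s) (by rw [if_neg hs]), zero_mul]
    · obtain ⟨s, hs⟩ := Function.ne_iff.1 h
      rw [Finset.prod_eq_zero (f := fun s => (starRingEnd ℂ) _) (Finset.mem_univ s)
        (by rw [if_neg hs, map_zero]), mul_zero]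

lemma tensorTT_conjTranspose (q t : ℕ) (A : Matrix (Fin q) (Fin q) ℂ) :
    tensorTT q t A.conjTranspose = (tensorTT q t A).conjTranspose := by
  ext i j
  simp [tensorTT, Matrix.conjTranspose_apply]

lemma tensorTT_smul (q t : ℕ) (z : ℂ) (hz : ‖z‖ = 1) (A : Matrix (Fin q) (Fin q) ℂ) :
    tensorTT q t (z • A) = tensorTT q t A := by
  ext i j
  simp only [tensorTT, Matrix.of_apply, Matrix.smul_apply, smul_eq_mul, map_mul,
    Finset.prod_mul_distrib, Finset.prod_const, Finset.card_univ, Fintype.card_fin]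
  have : z ^ t * (starRingEnd ℂ) z ^ t = 1 := by
    rw [← mul_pow, Complex.mul_conj, Complex.normSq_eq_norm_sq, hz]; simp
  linear_combination (∏ x, A (i.1 x) (j.1 x)) * (∏ x, (starRingEnd ℂ) (A (i.2 x) (j.2 x))) * this

lemma tensorTT_trace (q t : ℕ) (A : Matrix (Fin q) (Fin q) ℂ) :
    (tensorTT q t A).trace = ((‖A.trace‖ ^ (2 * t) : ℝ) : ℂ) := by
  have h1 : (tensorTT q t A).trace = A.trace ^ t * (starRingEnd ℂ) A.trace ^ t := by
    have e : ∀ f : Fin q → ℂ, (∑ a, f a) ^ t = ∑ i : Fin t → Fin q, ∏ s, f (i s) := by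
      intro f
      have := Finset.prod_univ_sum (fun _ : Fin t => (Finset.univ : Finset (Fin q)))
        (fun _ a => f a)
      simpa [Fintype.piFinset_univ] using this
    simp only [Matrix.trace, Matrix.diag, map_sum]
    rw [e, e, Finset.sum_mul_sum, ← Finset.sum_product', Finset.univ_product_univ]
    rfl
  rw [h1, ← mul_pow, Complex.mul_conj, Complex.normSq_eq_norm_sq, pow_mul]
  push_cast; rfl

lemma continuous_tensorTT (q t : ℕ) : Continuous (tensorTT q t) := by
  refine continuous_matrix fun i j => ?_
  simp only [tensorTT, Matrix.of_apply]
  have : ∀ a b, Continuous fun A : Matrix (Fin q) (Fin q) ℂ => A a b := fun a b =>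
    continuous_id.matrix_elem a b
  refine Continuous.mul (continuous_finsetProd _ fun s _ => this _ _) 
    (continuous_finsetProd _ fun s _ => Complex.continuous_conj.comp (this _ _))

instance unitary_compactSpace (q : ℕ) : CompactSpace (Matrix.unitaryGroup (Fin q) ℂ) := by
  refine (isCompact_iff_compactSpace (s := ((Matrix.unitaryGroup (Fin q) ℂ : Submonoid _) : Set (Matrix (Fin q) (Fin q) ℂ)))).1 ?_
  let _ : NormedAddCommGroup (Matrix (Fin q) (Fin q) ℂ) := Matrix.normedAddCommGroup
  let _ : NormedSpace ℂ (Matrix (Fin q) (Fin q) ℂ) := Matrix.normedSpace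
  have : ProperSpace (Matrix (Fin q) (Fin q) ℂ) := FiniteDimensional.proper ℂ _
  refine Metric.isCompact_of_isClosed_isBounded ?_ ?_
  · have : ((Matrix.unitaryGroup (Fin q) ℂ : Submonoid _) : Set (Matrix (Fin q) (Fin q) ℂ)) =
      {A | A * star A = 1} := by
      ext A; exact Matrix.mem_unitaryGroup_iff
    rw [this]
    exact isClosed_eq (by fun_prop) continuous_const
  · refine (Metric.isBounded_iff_subset_closedBall 0).2 ⟨1, fun A hA => ?_⟩
    rw [mem_closedBall_zero_iff]
    exact entrywise_sup_norm_bound_of_unitary hA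

open scoped Matrix.Norms.L2Operator
lemma opNorm_eq {n : Type*} [Fintype n] [DecidableEq n] (A : Matrix n n ℂ) : opNorm A = ‖A‖ := rfl

section
variable (q t : ℕ)
    (μ : Measure (Matrix.unitaryGroup (Fin q) ℂ))
    [IsProbabilityMeasure μ]

lemma integrable_entry (i j) : Integrable
    (fun U : Matrix.unitaryGroup (Fin q) ℂ => tensorTT q t (U : Matrix (Fin q) (Fin q) ℂ) i j) μ := by
  have : Continuous (fun U : Matrix.unitaryGroup (Fin q) ℂ =>
      tensorTT q t (U : Matrix (Fin q) (Fin q) ℂ) i j) :=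
    ((continuous_tensorTT q t).comp continuous_subtype_val).matrix_elem i j
  exact this.integrable_of_hasCompactSupport (HasCompactSupport.of_compactSpace _)

lemma tensor_mul_MHaar [μ.IsMulLeftInvariant] (V : Matrix.unitaryGroup (Fin q) ℂ) :
    tensorTT q t (V : Matrix (Fin q) (Fin q) ℂ) * MHaarOp q t μ = MHaarOp q t μ := by
  ext i j
  simp only [Matrix.mul_apply, MHaarOp, Matrix.of_apply]
  simp_rw [← integral_const_mul]
  rw [← integral_finsetSum _ fun k _ => (integrable_entry q t μ k j).const_mul _]
  rw [← integral_mul_left_eq_self (fun W : Matrix.unitaryGroup (Fin q) ℂ => tensorTT q t (W : Matrix (Fin q) (Fin q) ℂ) i j) V]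
  congr 1; ext W
  rw [Submonoid.coe_mul, tensorTT_mul, Matrix.mul_apply]

instance unitary_openPos [μ.IsMulLeftInvariant] : μ.IsOpenPosMeasure :=
  isOpenPosMeasure_of_mulLeftInvariant_of_compact Set.univ isCompact_univ (by simp)

instance unitary_rightInv [μ.IsMulLeftInvariant] : μ.IsMulRightInvariant := by
  have : μ.IsHaarMeasure := {}
  refine ⟨fun g => ?_⟩
  have : IsProbabilityMeasure (μ.map (· * g)) :=
    Measure.isProbabilityMeasure_map (measurable_mul_const g).aemeasurable
  have : (μ.map (· * g)).IsHaarMeasure := {}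
  exact Measure.isHaarMeasure_eq_of_isProbabilityMeasure _ _

lemma MHaar_mul_tensor [μ.IsMulLeftInvariant] (V : Matrix.unitaryGroup (Fin q) ℂ) :
    MHaarOp q t μ * tensorTT q t (V : Matrix (Fin q) (Fin q) ℂ) = MHaarOp q t μ := by
  ext i j
  simp only [Matrix.mul_apply, MHaarOp, Matrix.of_apply]
  simp_rw [← integral_mul_const]
  rw [← integral_finsetSum _ fun k _ => (integrable_entry q t μ i k).mul_const _]
  rw [← integral_mul_right_eq_self (fun W : Matrix.unitaryGroup (Fin q) ℂ => tensorTT q t (W : Matrix (Fin q) (Fin q) ℂ) i j) V]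
  congr 1; ext W
  rw [Submonoid.coe_mul, tensorTT_mul, Matrix.mul_apply]

end

lemma unitary_diagonalize (q : ℕ) (V : Matrix.unitaryGroup (Fin q) ℂ) :
    ∃ (W : Matrix.unitaryGroup (Fin q) ℂ) (θ : Fin q → ℝ),
      (V : Matrix (Fin q) (Fin q) ℂ) = W * Matrix.diagonal (fun j => Complex.exp (θ j * Complex.I)) *
        star (W : Matrix (Fin q) (Fin q) ℂ) := by
  have hfin : (spectrum ℂ (V : Matrix (Fin q) (Fin q) ℂ)).Finite := Matrix.finite_spectrum _
  have hV : IsStarNormal (V : Matrix (Fin q) (Fin q) ℂ) := inferInstance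
  have hc : ∀ f : ℂ → ℂ, ContinuousOn f (spectrum ℂ (V : Matrix (Fin q) (Fin q) ℂ)) :=
    fun f => hfin.continuousOn f
  set H := cfc (fun z : ℂ => (Complex.arg z : ℂ)) (V : Matrix (Fin q) (Fin q) ℂ) with hH
  have hHs : H.IsHermitian := by
    change star H = H
    rw [hH, ← cfc_star]
    simp
  have hexp : NormedSpace.exp (Complex.I • H) = (V : Matrix (Fin q) (Fin q) ℂ) := by
    rw [hH, ← cfc_smul _ _ _ (hc _), ← CFC.exp_eq_normedSpace_exp (𝕜 := ℂ), ← cfc_comp' _ _ _ ?_ (hc _)]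
    · conv_rhs => rw [← cfc_id ℂ (V : Matrix (Fin q) (Fin q) ℂ)]
      refine cfc_congr fun z hz => ?_
      have hz1 : ‖z‖ = 1 := by
        have := spectrum_subset_unitary_of_mem_unitary V.2 hz
        have := (Unitary.mem_iff.1 this).1
        have h2 : ‖star z * z‖ = 1 := by rw [this]; simp
        rw [norm_mul, norm_star] at h2
        nlinarith [norm_nonneg z]
      have := Complex.norm_mul_exp_arg_mul_I z
      rw [hz1] at this
      simp only [← Complex.exp_eq_exp_ℂ, smul_eq_mul, id]
      rw [mul_comm]; simpa using this
    · rw [← Complex.exp_eq_exp_ℂ]; exact Complex.continuous_exp.continuousOn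
  obtain ⟨W, d, hW⟩ : ∃ (W : Matrix.unitaryGroup (Fin q) ℂ) (d : Fin q → ℝ),
      H = W * Matrix.diagonal (fun j => (d j : ℂ)) * star (W : Matrix (Fin q) (Fin q) ℂ) := by
    refine ⟨hHs.eigenvectorUnitary, hHs.eigenvalues, ?_⟩
    have := hHs.spectral_theorem
    rw [Unitary.conjStarAlgAut_apply] at this
    exact this
  refine ⟨W, d, ?_⟩
  have hWinv : (W : Matrix (Fin q) (Fin q) ℂ)⁻¹ = star (W : Matrix (Fin q) (Fin q) ℂ) :=
    Matrix.inv_eq_right_inv (Unitary.mul_star_self_of_mem W.2)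
  have hWu : IsUnit (W : Matrix (Fin q) (Fin q) ℂ) :=
    ⟨⟨W, star W, Unitary.mul_star_self_of_mem W.2, Unitary.star_mul_self_of_mem W.2⟩, rfl⟩
  rw [← hexp, hW, ← hWinv]
  rw [← Matrix.smul_mul, ← Matrix.mul_smul, ← Matrix.diagonal_smul, Matrix.exp_conj _ _ hWu,
    Matrix.exp_diagonal]
  congr 3
  ext j
  rw [Pi.coe_exp, ← Complex.exp_eq_exp_ℂ]
  simp [mul_comm]

lemma opNorm_sq_le {q : ℕ} (A : Matrix (Fin q) (Fin q) ℂ) :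
    opNorm A ^ 2 ≤ (Matrix.trace (A.conjTranspose * A)).re := by
  have htr : (Matrix.trace (A.conjTranspose * A)).re = ∑ i, ∑ j, ‖A i j‖ ^ 2 := by
    simp only [Matrix.trace, Matrix.diag, Matrix.mul_apply, Matrix.conjTranspose_apply]
    rw [Finset.sum_comm, Complex.re_sum]
    refine Finset.sum_congr rfl fun i _ => ?_
    rw [Complex.re_sum]
    refine Finset.sum_congr rfl fun j _ => ?_
    rw [← Complex.normSq_eq_norm_sq, Complex.star_def, ← Complex.normSq_eq_conj_mul_self]
    simp
  rw [htr]
  set F := ∑ i, ∑ j, ‖A i j‖ ^ 2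
  have hF : 0 ≤ F := by positivity
  have : opNorm A ≤ Real.sqrt F := by
    refine ContinuousLinearMap.opNorm_le_bound _ (Real.sqrt_nonneg _) fun x => ?_
    rw [EuclideanSpace.norm_eq, EuclideanSpace.norm_eq, ← Real.sqrt_mul hF]
    refine Real.sqrt_le_sqrt ?_
    rw [Finset.sum_mul]
    refine Finset.sum_le_sum fun i _ => ?_
    rw [Matrix.ofLp_toEuclideanCLM]
    calc ‖(A.mulVec x) i‖ ^ 2 ≤ (∑ j, ‖A i j‖ * ‖x j‖) ^ 2 := by
          gcongr
          change ‖∑ j, A i j * x j‖ ≤ _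
          refine (norm_sum_le _ _).trans ?_
          simp
      _ ≤ _ := Finset.sum_mul_sq_le_sq_mul_sq _ _ _
  calc opNorm A ^ 2 ≤ Real.sqrt F ^ 2 := by
        gcongr
        exact norm_nonneg _
    _ = F := Real.sq_sqrt hF

lemma exists_phase (z : ℂ) (hz : ‖z‖ = 1) :
    ∃ φ ∈ Set.Ico 0 (2 * Real.pi), Complex.exp (φ * Complex.I) = z := by
  have h := Complex.norm_mul_exp_arg_mul_I z
  rw [hz, Complex.ofReal_one, one_mul] at h
  by_cases h0 : 0 ≤ z.arg
  · exact ⟨z.arg, ⟨h0, by linarith [Complex.arg_le_pi z, Real.pi_pos]⟩, h⟩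
  · refine ⟨z.arg + 2 * Real.pi, ⟨by linarith [Complex.neg_pi_lt_arg z, Real.pi_pos],
      by linarith⟩, ?_⟩
    push_cast
    rw [add_mul, Complex.exp_add, h, Complex.exp_two_pi_mul_I, mul_one]

lemma Ddist_sq_le {q : ℕ} (V W : Matrix.unitaryGroup (Fin q) ℂ) :
    Ddist q (V : Matrix (Fin q) (Fin q) ℂ) (W : Matrix (Fin q) (Fin q) ℂ) ^ 2 ≤
      2 * q - 2 * ‖(star (V : Matrix (Fin q) (Fin q) ℂ) * (W : Matrix (Fin q) (Fin q) ℂ)).trace‖ := by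
  set τ := (star (V : Matrix (Fin q) (Fin q) ℂ) * (W : Matrix (Fin q) (Fin q) ℂ)).trace with hτ
  obtain ⟨z, hz, hzt⟩ : ∃ z : ℂ, ‖z‖ = 1 ∧ z * τ = ‖τ‖ := by
    by_cases h0 : τ = 0
    · exact ⟨1, by simp, by simp [h0]⟩
    · refine ⟨(starRingEnd ℂ) τ / ‖τ‖, by simp [h0], ?_⟩
      have : (‖τ‖ : ℂ) ≠ 0 := by simpa using h0
      rw [div_mul_eq_mul_div, Complex.conj_mul', div_eq_iff this, sq]
  obtain ⟨φ, hφ, rfl⟩ := exists_phase z hz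
  set z := Complex.exp (φ * Complex.I)
  have h1 : Ddist q (V : Matrix (Fin q) (Fin q) ℂ) (W : Matrix (Fin q) (Fin q) ℂ) ≤
      opNorm ((V : Matrix (Fin q) (Fin q) ℂ) - z • (W : Matrix (Fin q) (Fin q) ℂ)) := by
    refine csInf_le ⟨0, ?_⟩ ⟨φ, hφ, rfl⟩
    rintro _ ⟨_, _, rfl⟩
    exact norm_nonneg _
  have h0 : 0 ≤ Ddist q (V : Matrix (Fin q) (Fin q) ℂ) (W : Matrix (Fin q) (Fin q) ℂ) := by
    refine Real.sInf_nonneg ?_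
    rintro _ ⟨_, _, rfl⟩
    exact norm_nonneg _
  refine (pow_le_pow_left₀ h0 h1 2).trans ((opNorm_sq_le _).trans (le_of_eq ?_))
  have hVV : (V : Matrix (Fin q) (Fin q) ℂ).conjTranspose * (V : Matrix (Fin q) (Fin q) ℂ) = 1 :=
    Unitary.star_mul_self_of_mem V.2
  have hWW : (W : Matrix (Fin q) (Fin q) ℂ).conjTranspose * (W : Matrix (Fin q) (Fin q) ℂ) = 1 :=
    Unitary.star_mul_self_of_mem W.2
  have hτ' : ((W : Matrix (Fin q) (Fin q) ℂ).conjTranspose * (V : Matrix (Fin q) (Fin q) ℂ)).trace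
      = star τ := by
    rw [hτ, ← Matrix.trace_conjTranspose, Matrix.conjTranspose_mul, Matrix.star_eq_conjTranspose,
      Matrix.conjTranspose_conjTranspose]
  have hzz : star z * z = 1 := by
    rw [Complex.star_def, Complex.conj_mul', hz]; simp
  rw [Matrix.conjTranspose_sub, Matrix.conjTranspose_smul, sub_mul, mul_sub, mul_sub, hVV,
    Matrix.smul_mul, Matrix.smul_mul, Matrix.mul_smul, Matrix.mul_smul, hWW, smul_smul, hzz,
    Matrix.trace_sub, Matrix.trace_sub, Matrix.trace_sub, Matrix.trace_smul, Matrix.trace_smul,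
    hτ', ← Matrix.star_eq_conjTranspose, ← hτ, one_smul, smul_eq_mul, smul_eq_mul, ← star_mul',
    hzt]
  simp
  ring

/-- The diagonal unitary with phases `θ`. -/
noncomputable def diagU {q : ℕ} (θ : Fin q → ℝ) : Matrix.unitaryGroup (Fin q) ℂ :=
  ⟨Matrix.diagonal (fun j => Complex.exp (θ j * Complex.I)), by
    rw [Matrix.mem_unitaryGroup_iff, Matrix.star_eq_conjTranspose, Matrix.diagonal_conjTranspose,
      Matrix.diagonal_mul_diagonal, ← Matrix.diagonal_one]
    congr 1
    ext j
    rw [Pi.star_apply, Complex.star_def, Complex.mul_conj', Complex.norm_exp_ofReal_mul_I]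
    simp⟩

lemma diagU_add {q : ℕ} (θ θ' : Fin q → ℝ) : diagU (θ + θ') = diagU θ * diagU θ' := by
  apply Subtype.ext
  simp only [diagU, Submonoid.coe_mul, Matrix.diagonal_mul_diagonal]
  congr 1
  ext j
  rw [← Complex.exp_add]
  simp [add_mul]

/-- Permutation matrices are unitary. -/
noncomputable def permU {q : ℕ} (σ : Equiv.Perm (Fin q)) : Matrix.unitaryGroup (Fin q) ℂ :=
  ⟨Matrix.of fun i j => if σ i = j then 1 else 0, by
    rw [Matrix.mem_unitaryGroup_iff]
    ext i j
    simp [Matrix.mul_apply, Matrix.one_apply, eq_comm]⟩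

lemma permU_mul_diagU {q : ℕ} (σ : Equiv.Perm (Fin q)) (θ : Fin q → ℝ) :
    permU σ * diagU θ = diagU (θ ∘ σ) * permU σ := by
  apply Subtype.ext
  simp only [diagU, permU, Submonoid.coe_mul]
  ext i j
  rw [Matrix.mul_diagonal, Matrix.diagonal_mul]
  by_cases h : σ i = j <;> simp [h]

lemma character_trivial (q : ℕ) (hq : 1 ≤ q) (χ : Matrix.unitaryGroup (Fin q) ℂ →* ℂ)
    (hχ : ∀ c : ℝ, χ (diagU fun _ => c) = 1) (V : Matrix.unitaryGroup (Fin q) ℂ) : χ V = 1 := by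
  have hne : ∀ W, χ W ≠ 0 := fun W h => by
    have : χ (W * W⁻¹) = 1 := by simp
    rw [map_mul, h, zero_mul] at this
    exact zero_ne_one this
  have hsum : ∀ (s : Finset (Fin q)) (f : Fin q → Fin q → ℝ),
      χ (diagU (∑ k ∈ s, f k)) = ∏ k ∈ s, χ (diagU (f k)) := by
    intro s f
    induction s using Finset.induction_on with
    | empty => rw [Finset.sum_empty, Finset.prod_empty]; exact hχ 0
    | insert a s ha ih => rw [Finset.sum_insert ha, Finset.prod_insert ha, diagU_add, map_mul, ih]
  have hperm : ∀ (σ : Equiv.Perm (Fin q)) θ, χ (diagU (θ ∘ σ)) = χ (diagU θ) := by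
    intro σ θ
    have := congrArg χ (permU_mul_diagU σ θ)
    rw [map_mul, map_mul, mul_comm] at this
    exact (mul_right_cancel₀ (hne _) this).symm
  have : NeZero q := ⟨by omega⟩
  have hpow : ∀ θ : Fin q → ℝ, χ (diagU θ) ^ q = 1 := by
    intro θ
    have h1 := hsum Finset.univ (fun k => θ ∘ Equiv.addRight k)
    simp_rw [hperm] at h1
    rw [Finset.prod_const, Finset.card_univ, Fintype.card_fin] at h1
    rw [← h1, ← hχ (∑ k, θ k)]
    congr 2
    ext i
    rw [Finset.sum_apply]
    exact Equiv.sum_comp (Equiv.addLeft i) θ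
  have hdiag : ∀ θ : Fin q → ℝ, χ (diagU θ) = 1 := by
    intro θ
    have h1 := hsum Finset.univ (fun _ => fun i => θ i / q)
    rw [Finset.prod_const, Finset.card_univ, Fintype.card_fin, hpow] at h1
    rw [← h1]
    congr 2
    ext i
    have : (q : ℝ) ≠ 0 := by positivity
    simp
    field_simp
  obtain ⟨W, θ, h⟩ := unitary_diagonalize q V
  have hV : V = W * diagU θ * W⁻¹ := Subtype.ext h
  rw [hV, map_mul, map_mul, hdiag, mul_one, ← map_mul]
  simp

lemma fixed_of_line (q t : ℕ) (hq : 1 ≤ q) (v : (Fin t → Fin q) × (Fin t → Fin q) → ℂ) (hv : v ≠ 0)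
    (h : ∀ V : Matrix.unitaryGroup (Fin q) ℂ, ∃ c : ℂ,
      (tensorTT q t (V : Matrix (Fin q) (Fin q) ℂ)).mulVec v = c • v)
    (V : Matrix.unitaryGroup (Fin q) ℂ) :
    (tensorTT q t (V : Matrix (Fin q) (Fin q) ℂ)).mulVec v = v := by
  choose χ hχ using h
  have hinj : ∀ a b : ℂ, a • v = b • v → a = b := fun a b hab => smul_left_injective ℂ hv hab
  let X : Matrix.unitaryGroup (Fin q) ℂ →* ℂ :=
    { toFun := χ
      map_one' := by
        apply hinj
        rw [← hχ, Submonoid.coe_one, tensorTT_one, Matrix.one_mulVec, one_smul]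
      map_mul' := by
        intro A B
        apply hinj
        rw [← hχ, Submonoid.coe_mul, tensorTT_mul, ← Matrix.mulVec_mulVec, hχ, Matrix.mulVec_smul,
          hχ, smul_smul, mul_comm] }
  have := character_trivial q hq X (by
    intro c
    apply hinj
    change χ _ • v = _
    have e : ((diagU fun _ : Fin q => c : Matrix.unitaryGroup (Fin q) ℂ) : Matrix (Fin q) (Fin q) ℂ)
        = Complex.exp (c * Complex.I) • 1 := by
      rw [← Matrix.diagonal_one, ← Matrix.diagonal_smul]
      simp only [diagU]
      congr 1; ext; simp
    rw [← hχ, e, tensorTT_smul _ _ _ (Complex.norm_exp_ofReal_mul_I c), tensorTT_one,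
      Matrix.one_mulVec, one_smul]) V
  rw [hχ]
  change χ V = 1 at this
  rw [this, one_smul]

lemma line_of_universal (q t : ℕ) (S : Set (Matrix.unitaryGroup (Fin q) ℂ))
    (hS : IsUniversalGateSet q S)
    (v : (Fin t → Fin q) × (Fin t → Fin q) → ℂ) (l : ℂ)
    (h : ∀ V ∈ S, (tensorTT q t (V : Matrix (Fin q) (Fin q) ℂ)).mulVec v = l • v)
    (V : Matrix.unitaryGroup (Fin q) ℂ) :
    ∃ c : ℂ, (tensorTT q t (V : Matrix (Fin q) (Fin q) ℂ)).mulVec v = c • v := by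
  have hw : ∀ ws : List (Matrix.unitaryGroup (Fin q) ℂ), (∀ w ∈ ws, w ∈ S) →
      ∃ c : ℂ, (tensorTT q t ((ws.prod : Matrix.unitaryGroup (Fin q) ℂ) :
        Matrix (Fin q) (Fin q) ℂ)).mulVec v = c • v := by
    intro ws
    induction ws with
    | nil => intro _; exact ⟨1, by simp [tensorTT_one]⟩
    | cons a ws ih =>
      intro hws
      obtain ⟨c, hc⟩ := ih fun w hw => hws w (List.mem_cons_of_mem _ hw)
      refine ⟨c * l, ?_⟩
      rw [List.prod_cons, Submonoid.coe_mul, tensorTT_mul, ← Matrix.mulVec_mulVec, hc,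
        Matrix.mulVec_smul, h a (hws a List.mem_cons_self), smul_smul]
  set C : Set (Matrix (Fin q) (Fin q) ℂ) :=
    {A | (tensorTT q t A).mulVec v ∈ Submodule.span ℂ {v}} with hC
  have hCc : IsClosed C := by
    have h1 : IsClosed ((Submodule.span ℂ {v} : Submodule ℂ _) :
        Set ((Fin t → Fin q) × (Fin t → Fin q) → ℂ)) := Submodule.closed_of_finiteDimensional _
    exact h1.preimage (Continuous.matrix_mulVec (continuous_tensorTT q t) continuous_const)
  have hmem : (V : Matrix (Fin q) (Fin q) ℂ) ∈ C := by
    rw [← hCc.closure_eq, Metric.mem_closure_iff]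
    intro ε hε
    obtain ⟨ws, hws, hD⟩ := hS V (ε / 2) (by linarith)
    have hlt : Ddist q (V : Matrix (Fin q) (Fin q) ℂ)
        ((ws.prod : Matrix.unitaryGroup (Fin q) ℂ) : Matrix (Fin q) (Fin q) ℂ) < ε := by linarith
    obtain ⟨_, ⟨φ, hφ, rfl⟩, hlt⟩ := exists_lt_of_csInf_lt
      (Set.Nonempty.image _ ⟨0, by simp [Real.pi_pos]⟩) hlt
    refine ⟨_, ?_, by rw [dist_eq_norm]; exact hlt⟩
    rw [hC, Set.mem_ofPred_eq, tensorTT_smul _ _ _ (Complex.norm_exp_ofReal_mul_I φ),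
      Submodule.mem_span_singleton]
    obtain ⟨c, hc⟩ := hw ws hws
    exact ⟨c, hc.symm⟩
  obtain ⟨c, hc⟩ := Submodule.mem_span_singleton.1 hmem
  exact ⟨c, hc.symm⟩

lemma MHaar_mulVec_of_fixed (q t : ℕ) (μ : Measure (Matrix.unitaryGroup (Fin q) ℂ))
    [IsProbabilityMeasure μ]
    (v : (Fin t → Fin q) × (Fin t → Fin q) → ℂ)
    (h : ∀ V : Matrix.unitaryGroup (Fin q) ℂ,
      (tensorTT q t (V : Matrix (Fin q) (Fin q) ℂ)).mulVec v = v) :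
    (MHaarOp q t μ).mulVec v = v := by
  ext i
  simp only [Matrix.mulVec, dotProduct, MHaarOp, Matrix.of_apply]
  simp_rw [← integral_mul_const]
  rw [← integral_finsetSum _ fun k _ => (integrable_entry q t μ i k).mul_const _]
  have : ∀ V : Matrix.unitaryGroup (Fin q) ℂ,
      ∑ j, tensorTT q t (V : Matrix (Fin q) (Fin q) ℂ) i j * v j = v i := fun V => congrFun (h V) i
  simp_rw [this]
  simp

section main
variable (q t m : ℕ) (p : Fin m → ℝ) (U : Fin m → Matrix.unitaryGroup (Fin q) ℂ)
    (μ : Measure (Matrix.unitaryGroup (Fin q) ℂ))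
    [μ.IsMulLeftInvariant] [IsProbabilityMeasure μ]

lemma moment_mul_MHaar (hpsum : ∑ k, p k = 1) : momentOp q t m p U * MHaarOp q t μ = MHaarOp q t μ := by
  rw [momentOp, Finset.sum_mul]
  simp_rw [Matrix.smul_mul, tensor_mul_MHaar]
  rw [← Finset.sum_smul, ← Complex.ofReal_sum, hpsum]; simp

lemma MHaar_mul_moment (hpsum : ∑ k, p k = 1) : MHaarOp q t μ * momentOp q t m p U = MHaarOp q t μ := by
  rw [momentOp, Finset.mul_sum]
  simp_rw [Matrix.mul_smul, MHaar_mul_tensor]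
  rw [← Finset.sum_smul, ← Complex.ofReal_sum, hpsum]; simp

lemma MHaar_idem : MHaarOp q t μ * MHaarOp q t μ = MHaarOp q t μ := by
  ext i j
  have := congrFun (MHaar_mulVec_of_fixed q t μ (fun k => MHaarOp q t μ k j) (by
    intro V
    ext k
    exact congrFun (congrFun (tensor_mul_MHaar q t μ V) k) j)) i
  exact this

open scoped ComplexOrder in
lemma eigen_strict (hpsum : ∑ k, p k = 1) (hp : ∀ k, 0 ≤ p k) (v : (Fin t → Fin q) × (Fin t → Fin q) → ℂ) (l : ℂ)
    (hl : 1 ≤ ‖l‖) (h : (momentOp q t m p U).mulVec v = l • v) (k : Fin m) (hk : 0 < p k) :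
    (tensorTT q t (U k : Matrix (Fin q) (Fin q) ℂ)).mulVec v = l • v := by
  set T : Fin m → Matrix ((Fin t → Fin q) × (Fin t → Fin q)) ((Fin t → Fin q) × (Fin t → Fin q)) ℂ :=
    fun k => tensorTT q t (U k : Matrix (Fin q) (Fin q) ℂ) with hT
  have hTu : ∀ k, dotProduct (star ((T k).mulVec v)) ((T k).mulVec v) = dotProduct (star v) v := by
    intro k
    rw [Matrix.star_mulVec, ← Matrix.dotProduct_mulVec, Matrix.mulVec_mulVec, hT]
    simp only
    rw [← tensorTT_conjTranspose, ← tensorTT_mul]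
    have : (U k : Matrix (Fin q) (Fin q) ℂ).conjTranspose * (U k : Matrix (Fin q) (Fin q) ℂ) = 1 :=
      Unitary.star_mul_self_of_mem (U k).2
    rw [this, tensorTT_one, Matrix.one_mulVec]
  have hM : ∑ k, (p k : ℂ) • (T k).mulVec v = l • v := by
    rw [← h, momentOp, Matrix.sum_mulVec]
    simp_rw [Matrix.smul_mulVec]; rfl
  set s := dotProduct (star v) v with hs
  have hs0 : 0 ≤ s := dotProduct_star_self_nonneg v
  have hps : ∑ k, (p k : ℂ) = 1 := by rw [← Complex.ofReal_sum, hpsum]; simp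
  have e1 : ∑ k, (p k : ℂ) * dotProduct (star (l • v)) ((T k).mulVec v) = star l * l * s := by
    simp_rw [← smul_eq_mul (p _ : ℂ), ← dotProduct_smul]
    rw [← dotProduct_sum, hM, star_smul, smul_dotProduct, dotProduct_smul]
    simp [hs, mul_assoc]
  have e2 : ∑ k, (p k : ℂ) * dotProduct (star ((T k).mulVec v)) (l • v) = star l * l * s := by
    have : ∑ k, (p k : ℂ) • star ((T k).mulVec v) = star (l • v) := by
      rw [← hM, star_sum]
      refine Finset.sum_congr rfl fun k _ => ?_
      rw [star_smul]; simp
    simp_rw [← smul_eq_mul (p _ : ℂ), ← smul_dotProduct]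
    rw [← sum_dotProduct, this, star_smul, smul_dotProduct, dotProduct_smul]
    simp [hs, mul_assoc]
  have key : ∑ k, (p k : ℂ) * dotProduct (star ((T k).mulVec v - l • v)) ((T k).mulVec v - l • v) =
      (1 - star l * l) * s := by
    have : ∀ k, (p k : ℂ) * dotProduct (star ((T k).mulVec v - l • v)) ((T k).mulVec v - l • v) =
        (p k : ℂ) * (s + star l * l * s) - (p k : ℂ) * dotProduct (star (l • v)) ((T k).mulVec v) -
        (p k : ℂ) * dotProduct (star ((T k).mulVec v)) (l • v) := by
      intro k
      have : dotProduct (star (l • v)) (l • v) = star l * l * s := by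
        rw [star_smul, smul_dotProduct, dotProduct_smul]; simp [hs, mul_assoc]
      rw [star_sub, sub_dotProduct, dotProduct_sub, dotProduct_sub, hTu, this]
      ring
    simp_rw [this]
    rw [Finset.sum_sub_distrib, Finset.sum_sub_distrib, e1, e2, ← Finset.sum_mul, hps]
    ring
  have hle : (1 - star l * l) * s ≤ 0 := by
    refine mul_nonpos_of_nonpos_of_nonneg ?_ hs0
    rw [Complex.star_def, Complex.conj_mul', sub_nonpos]
    exact_mod_cast one_le_pow₀ hl
  have hnn : ∀ k ∈ Finset.univ, 0 ≤ (p k : ℂ) *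
      dotProduct (star ((T k).mulVec v - l • v)) ((T k).mulVec v - l • v) := fun k _ =>
    mul_nonneg (by exact_mod_cast hp k) (dotProduct_star_self_nonneg _)
  have h0 := le_antisymm (key.trans_le hle) (Finset.sum_nonneg hnn)
  have := (Finset.sum_eq_zero_iff_of_nonneg hnn).1 h0 k (Finset.mem_univ _)
  have hk' : (p k : ℂ) ≠ 0 := by exact_mod_cast hk.ne'
  exact sub_eq_zero.1 (dotProduct_star_self_eq_zero.1 ((mul_eq_zero.1 this).resolve_left hk'))

lemma radius_of_universal (hpsum : ∑ k, p k = 1) (hq : 1 ≤ q) (hp : ∀ k, 0 ≤ p k)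
    (hS : IsUniversalGateSet q {W | ∃ k, 0 < p k ∧ U k = W}) :
    spectralRadius ℂ (momentOp q t m p U - MHaarOp q t μ) < 1 := by
  have : NeZero q := ⟨by omega⟩
  refine spectrum.spectralRadius_lt_of_forall_lt (r := 1) _ fun l hl => ?_
  by_contra hcon
  have hl1 : 1 ≤ ‖l‖ := by
    have h' := not_lt.1 hcon
    exact_mod_cast h'
  have hl0 : l ≠ 0 := by rintro rfl; simp at hl1; linarith
  rw [spectrum.mem_iff, Matrix.isUnit_iff_isUnit_det, isUnit_iff_ne_zero, not_not,
    ← Matrix.exists_mulVec_eq_zero_iff] at hl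
  obtain ⟨v, hv, hv2⟩ := hl
  rw [Matrix.sub_mulVec, Algebra.algebraMap_eq_smul_one, Matrix.smul_mulVec, Matrix.one_mulVec,
    sub_eq_zero] at hv2
  have hH : (MHaarOp q t μ).mulVec v = 0 := by
    have h1 := congrArg (MHaarOp q t μ).mulVec hv2
    rw [Matrix.mulVec_mulVec, mul_sub, MHaar_mul_moment q t m p U μ hpsum, MHaar_idem, sub_self,
      Matrix.zero_mulVec, Matrix.mulVec_smul] at h1
    exact (smul_eq_zero.1 h1).resolve_left hl0
  rw [Matrix.sub_mulVec, hH, sub_zero] at hv2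
  have h1 := eigen_strict q t m p U hpsum hp v l hl1 hv2.symm
  have h2 := line_of_universal q t _ hS v l (by
    rintro _ ⟨k, hk, rfl⟩
    exact h1 k hk)
  have h3 := MHaar_mulVec_of_fixed q t μ v (fixed_of_line q t hq v hv h2)
  exact hv (h3.symm.trans hH)

end main

lemma tendsto_pow_of_spectralRadius_lt_one {A : Type*} [NormedRing A] [NormedAlgebra ℂ A]
    [CompleteSpace A] (a : A) (h : spectralRadius ℂ a < 1) :
    Filter.Tendsto (fun n : ℕ => a ^ n) Filter.atTop (nhds 0) := by
  obtain ⟨r, hr1, hr2⟩ := ENNReal.lt_iff_exists_nnreal_btwn.1 h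
  have hr2 : r < 1 := by exact_mod_cast hr2
  have h1 := (spectrum.pow_nnnorm_pow_one_div_tendsto_nhds_spectralRadius a).eventually_lt_const hr1
  have h2 : ∀ᶠ n : ℕ in Filter.atTop, ‖a ^ n‖ ≤ (r : ℝ) ^ n := by
    filter_upwards [h1, Filter.eventually_ge_atTop 1] with n hn hn1
    have hn0 : (n : ℝ) ≠ 0 := by positivity
    have h3 : ((‖a ^ n‖₊ : ENNReal) ^ (1 / n : ℝ)) ^ (n : ℝ) ≤ (r : ENNReal) ^ (n : ℝ) :=
      ENNReal.rpow_le_rpow hn.le (by positivity)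
    rw [← ENNReal.rpow_mul, one_div_mul_cancel hn0, ENNReal.rpow_one, ENNReal.rpow_natCast] at h3
    exact_mod_cast h3
  exact squeeze_zero_norm' h2 (tendsto_pow_atTop_nhds_zero_of_lt_one r.2 (by exact_mod_cast hr2))

section main2
variable (q t m : ℕ) (p : Fin m → ℝ) (U : Fin m → Matrix.unitaryGroup (Fin q) ℂ)
    (μ : Measure (Matrix.unitaryGroup (Fin q) ℂ))
    [IsProbabilityMeasure μ]

lemma moment_pow_bound (hpsum : ∑ k, p k = 1) (hp : ∀ k, 0 ≤ p k)
    (V : Matrix.unitaryGroup (Fin q) ℂ) (K : ℝ)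
    (hK : ∀ ws : List (Matrix.unitaryGroup (Fin q) ℂ), (∀ w ∈ ws, ∃ k, 0 < p k ∧ U k = w) →
      (tensorTT q t (star (V : Matrix (Fin q) (Fin q) ℂ) *
        ((ws.prod : Matrix.unitaryGroup (Fin q) ℂ) : Matrix (Fin q) (Fin q) ℂ))).trace.re ≤ K)
    (n : ℕ) : ∀ ws : List (Matrix.unitaryGroup (Fin q) ℂ), (∀ w ∈ ws, ∃ k, 0 < p k ∧ U k = w) →
      (tensorTT q t (star (V : Matrix (Fin q) (Fin q) ℂ) *
        ((ws.prod : Matrix.unitaryGroup (Fin q) ℂ) : Matrix (Fin q) (Fin q) ℂ)) *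
        momentOp q t m p U ^ n).trace.re ≤ K := by
  induction n with
  | zero => simpa using hK
  | succ n ih =>
    intro ws hws
    rw [pow_succ', ← mul_assoc]
    conv_lhs => rw [momentOp]
    rw [Finset.mul_sum, Finset.sum_mul, Matrix.trace_sum, Complex.re_sum]
    calc _ ≤ ∑ k, p k * K := ?_
      _ = K := by rw [← Finset.sum_mul, hpsum, one_mul]
    refine Finset.sum_le_sum fun k _ => ?_
    rw [Matrix.mul_smul, Matrix.smul_mul, Matrix.trace_smul, smul_eq_mul, Complex.re_ofReal_mul]
    rcases (hp k).eq_or_lt with h0 | h0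
    · rw [← h0]; simp
    · refine mul_le_mul_of_nonneg_left ?_ h0.le
      have := ih (ws ++ [U k]) (by
        intro w hw
        rcases List.mem_append.1 hw with hw | hw
        · exact hws w hw
        · exact ⟨k, h0, (List.mem_singleton.1 hw).symm⟩)
      rw [List.prod_append, List.prod_singleton, Submonoid.coe_mul, ← mul_assoc,
        tensorTT_mul q t (_ * _)] at this
      exact this

lemma trace_mul_MHaar (V : Matrix.unitaryGroup (Fin q) ℂ) :
    (tensorTT q t (star (V : Matrix (Fin q) (Fin q) ℂ)) * MHaarOp q t μ).trace =
      ((∫ W : Matrix.unitaryGroup (Fin q) ℂ, ‖(star (V : Matrix (Fin q) (Fin q) ℂ) *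
        (W : Matrix (Fin q) (Fin q) ℂ)).trace‖ ^ (2 * t) ∂μ : ℝ) : ℂ) := by
  rw [← integral_complex_ofReal]
  simp only [Matrix.trace, Matrix.diag, Matrix.mul_apply, MHaarOp, Matrix.of_apply]
  simp_rw [← integral_const_mul]
  have hint : ∀ i j, Integrable (fun W : Matrix.unitaryGroup (Fin q) ℂ =>
      tensorTT q t (star (V : Matrix (Fin q) (Fin q) ℂ)) i j *
        tensorTT q t (W : Matrix (Fin q) (Fin q) ℂ) j i) μ := fun i j =>
    (integrable_entry q t μ j i).const_mul _
  simp_rw [← integral_finsetSum Finset.univ fun k _ => hint _ k]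
  rw [← integral_finsetSum _ fun k _ => integrable_finsetSum _ fun j _ => hint k j]
  congr 1
  ext W
  have := tensorTT_trace q t (star (V : Matrix (Fin q) (Fin q) ℂ) * (W : Matrix (Fin q) (Fin q) ℂ))
  rw [tensorTT_mul] at this
  simpa [Matrix.trace, Matrix.mul_apply] using this

lemma universal_of_radius [μ.IsMulLeftInvariant] (hq : 1 ≤ q) (hpsum : ∑ k, p k = 1)
    (hp : ∀ k, 0 ≤ p k)
    (h : ∀ t : ℕ, 1 ≤ t → spectralRadius ℂ (momentOp q t m p U - MHaarOp q t μ) < 1) :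
    IsUniversalGateSet q {W | ∃ k, 0 < p k ∧ U k = W} := by
  have : NeZero q := ⟨by omega⟩
  intro V ε hε
  by_contra! hcon
  set τ : Matrix.unitaryGroup (Fin q) ℂ → ℝ := fun W =>
    ‖(star (V : Matrix (Fin q) (Fin q) ℂ) * (W : Matrix (Fin q) (Fin q) ℂ)).trace‖ with hτ
  have hτc : Continuous τ := by
    refine Continuous.norm (Continuous.matrix_trace ?_)
    exact continuous_const.mul continuous_subtype_val
  have hτV : τ V = q := by
    have : star (V : Matrix (Fin q) (Fin q) ℂ) * (V : Matrix (Fin q) (Fin q) ℂ) = 1 :=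
      Unitary.star_mul_self_of_mem V.2
    simp [hτ, this]
  set c0 : ℝ := q - ε ^ 2 / 2 with hc0
  have hword : ∀ ws : List (Matrix.unitaryGroup (Fin q) ℂ), (∀ w ∈ ws, ∃ k, 0 < p k ∧ U k = w) →
      τ ws.prod ≤ c0 := by
    intro ws hws
    have h1 := Ddist_sq_le V ws.prod
    have h2 := hcon ws hws
    have h3 : ε ^ 2 ≤ 2 * q - 2 * τ ws.prod :=
      (pow_le_pow_left₀ hε.le h2.le 2).trans h1
    rw [hc0]; linarith
  have hc0nn : 0 ≤ c0 := (norm_nonneg _).trans (hword [] (by simp))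
  set c1 : ℝ := q - ε ^ 2 / 4 with hc1
  have hε2 : 0 < ε ^ 2 := by positivity
  have hc01 : c0 < c1 := by rw [hc0, hc1]; linarith
  have hc1pos : 0 < c1 := by linarith
  set O : Set (Matrix.unitaryGroup (Fin q) ℂ) := {W | c1 < τ W} with hO
  have hOo : IsOpen O := isOpen_lt continuous_const hτc
  have hOpos : 0 < μ.real O := by
    have : 0 < μ O := hOo.measure_pos μ ⟨V, by
      change c1 < τ V
      rw [hτV, hc1]; linarith⟩
    exact ENNReal.toReal_pos this.ne' (measure_ne_top _ _)
  -- upper bound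
  have hup : ∀ t, 1 ≤ t → ∫ W, τ W ^ (2 * t) ∂μ ≤ c0 ^ (2 * t) := by
    intro t ht
    have hpow : ∀ n, 1 ≤ n → (momentOp q t m p U - MHaarOp q t μ) ^ n =
        momentOp q t m p U ^ n - MHaarOp q t μ := by
      intro n hn
      induction n, hn using Nat.le_induction with
      | base => simp
      | succ n hn ih =>
        have e : momentOp q t m p U ^ n * MHaarOp q t μ = MHaarOp q t μ := by
          clear ih hn
          induction n with
          | zero => simp
          | succ n ih => rw [pow_succ, mul_assoc, moment_mul_MHaar q t m p U μ hpsum, ih]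
        rw [pow_succ, ih, sub_mul, mul_sub, mul_sub, MHaar_mul_moment q t m p U μ hpsum,
          MHaar_idem, e, sub_self, sub_zero, ← pow_succ]
    have hlim : Filter.Tendsto (fun n => momentOp q t m p U ^ n) Filter.atTop
        (nhds (MHaarOp q t μ)) := by
      have h1 := (tendsto_pow_of_spectralRadius_lt_one _ (h t ht)).add_const (MHaarOp q t μ)
      rw [zero_add] at h1
      refine h1.congr' ?_
      filter_upwards [Filter.eventually_ge_atTop 1] with n hn
      rw [hpow n hn, sub_add_cancel]
    have hcont : Continuous fun A : Matrix ((Fin t → Fin q) × (Fin t → Fin q))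
        ((Fin t → Fin q) × (Fin t → Fin q)) ℂ =>
        (tensorTT q t (star (V : Matrix (Fin q) (Fin q) ℂ)) * A).trace.re :=
      Complex.continuous_re.comp (Continuous.matrix_trace (continuous_const.mul continuous_id))
    have hlim2 := (hcont.tendsto _).comp hlim
    have hb := le_of_tendsto' hlim2 (b := c0 ^ (2 * t)) (fun n => by
      have := moment_pow_bound q t m p U hpsum hp V (c0 ^ (2 * t)) (by
        intro ws hws
        rw [tensorTT_trace, Complex.ofReal_re]
        exact pow_le_pow_left₀ (norm_nonneg _) (hword ws hws) _) n [] (by simp)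
      simpa using this)
    rw [trace_mul_MHaar, Complex.ofReal_re] at hb
    exact hb
  have hlow : ∀ t, c1 ^ (2 * t) * μ.real O ≤ ∫ W, τ W ^ (2 * t) ∂μ := by
    intro t
    have hint : Integrable (fun W => τ W ^ (2 * t)) μ :=
      (hτc.pow _).integrable_of_hasCompactSupport (HasCompactSupport.of_compactSpace _)
    calc c1 ^ (2 * t) * μ.real O = ∫ W in O, c1 ^ (2 * t) ∂μ := by
          rw [setIntegral_const, smul_eq_mul, mul_comm]
      _ ≤ ∫ W in O, τ W ^ (2 * t) ∂μ := by
          refine setIntegral_mono_on (integrable_const _) hint.integrableOn hOo.measurableSet ?_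
          intro W hW
          exact pow_le_pow_left₀ hc1pos.le (le_of_lt hW) _
      _ ≤ ∫ W, τ W ^ (2 * t) ∂μ :=
          setIntegral_le_integral hint (Filter.Eventually.of_forall fun W =>
            pow_nonneg (norm_nonneg _) _)
  have hlim : Filter.Tendsto (fun n : ℕ => ((c0 / c1) ^ 2) ^ n) Filter.atTop (nhds 0) := by
    refine tendsto_pow_atTop_nhds_zero_of_lt_one (by positivity) ?_
    have : c0 / c1 < 1 := (div_lt_one hc1pos).2 hc01
    exact pow_lt_one₀ (by positivity) this (by norm_num)
  have : μ.real O ≤ 0 := by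
    refine ge_of_tendsto hlim ?_
    filter_upwards [Filter.eventually_ge_atTop 1] with n hn
    have := (hlow n).trans (hup n hn)
    rw [← pow_mul, div_pow, le_div_iff₀ (by positivity), mul_comm]
    exact this
  linarith

end main2

/-- Lemma S11.  The spectral radius of `M_ν^{(t)} - M_Haar^{(t)}` is
strictly less than `1` for every `t ≥ 1` if and only if the support of `ν` is a
universal gate set. -/
theorem spectralRadius_lt_one_iff_universal
    (q m : ℕ) (hq : 1 ≤ q) (hm : 1 ≤ m)
    (p : Fin m → ℝ) (hp : ∀ k, 0 ≤ p k) (hpsum : ∑ k, p k = 1)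
    (U : Fin m → Matrix.unitaryGroup (Fin q) ℂ)
    (μ : Measure (Matrix.unitaryGroup (Fin q) ℂ))
    [μ.IsMulLeftInvariant] [IsProbabilityMeasure μ] :
    (∀ t : ℕ, 1 ≤ t →
        spectralRadius ℂ (momentOp q t m p U - MHaarOp q t μ) < 1) ↔
      IsUniversalGateSet q {W | ∃ k, 0 < p k ∧ U k = W} := by
  exact ⟨universal_of_radius q m p U μ hq hpsum hp, fun h t _ => radius_of_universal q t m p U μ hpsum hq hp h⟩
end
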